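/- Let s ≥ 3 and k be integers with 3 ≤ k ≤ 2^{s−1}, and put n = 2^s + 2^{s−1} + k. Then the product w_1^{2^s} · w_2^{2^s} · w_3^{2^{s−1}} is a nonzero element of A(k,n). -/

import Mathlib

open MvPolynomial TensorProduct

noncomputable section

/-- Weights for the grading: the variable `Sum.inl i` corresponds to the Stiefel-Whitney
class `w_{i+1}` (degree `i+1`), and `Sum.inr j` to the dual class `w̄_{j+1}` (degree `j+1`). -/
def grassWt (k m : ℕ) : Fin k ⊕ Fin m → ℕ :=
  Sum.elim (fun i => (i : ℕ) + 1) (fun j => (j : ℕ) + 1)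

/-- The relation `(1 + w_1 + ⋯ + w_k)·(1 + w̄_1 + ⋯ + w̄_m) - 1`. -/
def grassRel (k m : ℕ) : MvPolynomial (Fin k ⊕ Fin m) (ZMod 2) :=
  (1 + ∑ i : Fin k, X (Sum.inl i)) * (1 + ∑ j : Fin m, X (Sum.inr j)) - 1

/-- The ideal generated by the positive-degree weighted-homogeneous components of the relation. -/
def grassIdeal (k m : ℕ) : Ideal (MvPolynomial (Fin k ⊕ Fin m) (ZMod 2)) :=
  Ideal.span { p | ∃ d : ℕ, 0 < d ∧
    p = weightedHomogeneousComponent (grassWt k m) d (grassRel k m) }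

/-- `GrassCoh k m` is the ring `A(k, n)` with `m = n - k`, i.e. the mod 2 cohomology ring
of the Grassmannian `G_k(ℝ^{k+m})`. -/
abbrev GrassCoh (k m : ℕ) : Type :=
  MvPolynomial (Fin k ⊕ Fin m) (ZMod 2) ⧸ grassIdeal k m

/-- The Stiefel-Whitney class `w_{i+1}` in `A(k, k+m)`. -/
def sw (k m : ℕ) (i : Fin k) : GrassCoh k m :=
  Ideal.Quotient.mk (grassIdeal k m) (X (Sum.inl i))

abbrev S3 : Type := MvPolynomial (Fin 3) (ZMod 2)

lemma S3_two : (2 : S3) = 0 := CharTwo.two_eq_zero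

def xx : S3 := X 0
def yy : S3 := X 1
def zz : S3 := X 2

/-- elementary symmetric polynomials in three variables -/
def eE : ℕ → S3
  | 0 => 1
  | 1 => xx + yy + zz
  | 2 => xx * yy + yy * zz + xx * zz
  | 3 => xx * yy * zz
  | _ => 0

/-- `gH (j + 2)` is the complete homogeneous polynomial of degree `j` -/
def gH : ℕ → S3
  | 0 => 0
  | 1 => 0
  | 2 => 1
  | (n + 3) => eE 1 * gH (n + 2) + eE 2 * gH (n + 1) + eE 3 * gH n

def dD : S3 := (xx + yy) * (yy + zz) * (xx + zz)

def jJ (N : ℕ) : Ideal S3 := Ideal.span {xx ^ N, yy ^ N, zz ^ N}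

lemma dD_gH : ∀ n, dD * gH n =
    xx ^ n * (yy + zz) + yy ^ n * (xx + zz) + zz ^ n * (xx + yy)
  | 0 => by
      simp only [gH]; linear_combination (-(xx + yy + zz)) * S3_two
  | 1 => by
      simp only [gH]; linear_combination (-(xx * yy + yy * zz + xx * zz)) * S3_two
  | 2 => by
      simp only [gH, dD]; linear_combination (xx * yy * zz) * S3_two
  | (n + 3) => by
      have h0 := dD_gH n
      have h1 := dD_gH (n + 1)
      have h2 := dD_gH (n + 2)
      simp only [gH, eE]
      linear_combination (xx + yy + zz) * h2 + (xx * yy + yy * zz + xx * zz) * h1 +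
        (xx * yy * zz) * h0 +
        ((yy + zz) * xx ^ (n + 1) * (xx * (yy + zz) + yy * zz) +
         (xx + zz) * yy ^ (n + 1) * (yy * (xx + zz) + xx * zz) +
         (xx + yy) * zz ^ (n + 1) * (zz * (xx + yy) + xx * yy)) * S3_two

lemma jJ_x {N n : ℕ} (h : N ≤ n) : xx ^ n ∈ jJ N :=
  Ideal.mem_of_dvd _ (pow_dvd_pow _ h) (Ideal.subset_span (by simp))
lemma jJ_y {N n : ℕ} (h : N ≤ n) : yy ^ n ∈ jJ N :=
  Ideal.mem_of_dvd _ (pow_dvd_pow _ h) (Ideal.subset_span (by simp))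
lemma jJ_z {N n : ℕ} (h : N ≤ n) : zz ^ n ∈ jJ N :=
  Ideal.mem_of_dvd _ (pow_dvd_pow _ h) (Ideal.subset_span (by simp))

lemma dD_gH_mem {N n : ℕ} (h : N ≤ n) : dD * gH n ∈ jJ N := by
  rw [dD_gH]
  exact add_mem (add_mem (Ideal.mul_mem_right _ _ (jJ_x h)) (Ideal.mul_mem_right _ _ (jJ_y h)))
    (Ideal.mul_mem_right _ _ (jJ_z h))

/-- the ring map -/
def psi (k m : ℕ) : MvPolynomial (Fin k ⊕ Fin m) (ZMod 2) →ₐ[ZMod 2] S3 :=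
  aeval (Sum.elim (fun i => eE ((i : ℕ) + 1)) (fun j => gH ((j : ℕ) + 3)))

lemma comp_mono (k m d e : ℕ) (p : MvPolynomial (Fin k ⊕ Fin m) (ZMod 2))
    (hp : IsWeightedHomogeneous (grassWt k m) p e) :
    weightedHomogeneousComponent (grassWt k m) d p = if e = d then p else 0 := by
  split_ifs with h
  · subst h; exact hp.weightedHomogeneousComponent_same
  · exact hp.weightedHomogeneousComponent_ne d (Ne.symm h)

lemma comp_grassRel (k m d : ℕ) :
    weightedHomogeneousComponent (grassWt k m) d (grassRel k m) =
      (∑ i : Fin k, if (i : ℕ) + 1 = d then X (Sum.inl i) else 0) +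
      (∑ j : Fin m, if (j : ℕ) + 1 = d then X (Sum.inr j) else 0) +
      ∑ i : Fin k, ∑ j : Fin m,
        if ((i : ℕ) + 1) + ((j : ℕ) + 1) = d then X (Sum.inl i) * X (Sum.inr j) else 0 := by
  have : grassRel k m = (∑ i : Fin k, X (Sum.inl i)) + (∑ j : Fin m, X (Sum.inr j)) +
      ∑ i : Fin k, ∑ j : Fin m, X (Sum.inl i) * X (Sum.inr j) := by
    rw [grassRel, ← Finset.sum_mul_sum]; ring
  have hl : ∀ i : Fin k, IsWeightedHomogeneous (grassWt k m)
      (X (Sum.inl i) : MvPolynomial (Fin k ⊕ Fin m) (ZMod 2)) ((i : ℕ) + 1) := fun i =>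
    isWeightedHomogeneous_X _ _ _
  have hr : ∀ i : Fin m, IsWeightedHomogeneous (grassWt k m)
      (X (Sum.inr i) : MvPolynomial (Fin k ⊕ Fin m) (ZMod 2)) ((i : ℕ) + 1) := fun i =>
    isWeightedHomogeneous_X _ _ _
  rw [this]
  simp only [map_add, map_sum]
  congr 1
  · congr 1
    · exact Finset.sum_congr rfl fun i _ => comp_mono _ _ _ _ _ (hl i)
    · exact Finset.sum_congr rfl fun i _ => comp_mono _ _ _ _ _ (hr i)
  · exact Finset.sum_congr rfl fun i _ => Finset.sum_congr rfl fun j _ =>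
      comp_mono _ _ _ _ _ ((hl i).mul (hr j))

/-- partial sums -/
def tG (m d c : ℕ) : S3 := ∑ j : Fin m, if c + ((j : ℕ) + 1) = d then gH ((j : ℕ) + 3) else 0

lemma tG_eq (m d c : ℕ) : tG m d c = if c + 1 ≤ d ∧ d ≤ c + m then gH (d - c + 2) else 0 := by
  unfold tG
  split_ifs with h
  · rw [Finset.sum_eq_single (⟨d - c - 1, by omega⟩ : Fin m)]
    · simp only
      rw [if_pos (by omega)]
      congr 1; omega
    · intro b _ hb
      rw [if_neg]
      intro h'
      exact hb (Fin.ext (by simp only; omega))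
    · simp
  · exact Finset.sum_eq_zero fun j _ => if_neg (by have := j.2; omega)

lemma psi_comp (k m d : ℕ) (hk : 3 ≤ k) :
    psi k m (weightedHomogeneousComponent (grassWt k m) d (grassRel k m)) =
      (if 1 = d then eE 1 else 0) + (if 2 = d then eE 2 else 0) + (if 3 = d then eE 3 else 0) +
      tG m d 0 + (eE 1 * tG m d 1 + eE 2 * tG m d 2 + eE 3 * tG m d 3) := by
  obtain ⟨r, rfl⟩ := Nat.exists_eq_add_of_le' hk
  have key : ∀ f : ℕ → S3, (∑ i : Fin (r + 3), eE ((i : ℕ) + 1) * f ((i : ℕ) + 1)) =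
      eE 1 * f 1 + eE 2 * f 2 + eE 3 * f 3 := by
    intro f
    simp [Fin.sum_univ_succ, eE]
    ring
  have h1 := key (fun i => if i = d then 1 else 0)
  have h2 := key (fun i => tG m d i)
  simp only [mul_ite, mul_one, mul_zero] at h1
  rw [comp_grassRel]
  simp only [map_add, map_sum, apply_ite (psi (r+3) m), map_zero, map_mul]
  simp only [psi, aeval_X, Sum.elim_inl, Sum.elim_inr]
  rw [h1, ← h2]
  simp only [tG, Finset.mul_sum, mul_ite, mul_zero, zero_add]

lemma dD_tG (m d c : ℕ) (h : c + 1 ≤ d) : ∃ t, tG m d c = gH (d - c + 2) + t ∧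
    dD * t ∈ jJ (m + 3) := by
  rw [tG_eq]
  split_ifs with h'
  · exact ⟨0, by simp, by simp⟩
  · refine ⟨- gH (d - c + 2), by simp, ?_⟩
    rw [mul_neg]
    exact neg_mem (dD_gH_mem (by omega))

lemma dD_psi_comp (k m d : ℕ) (hk : 3 ≤ k) (hm : 3 ≤ m) (hd : 0 < d) :
    dD * psi k m (weightedHomogeneousComponent (grassWt k m) d (grassRel k m)) ∈ jJ (m + 3) := by
  rw [psi_comp k m d hk]
  rcases (by omega : d = 1 ∨ d = 2 ∨ d = 3 ∨ 4 ≤ d) with rfl | rfl | rfl | h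
  · have : (1:ℕ) ≤ m := by omega
    simp [tG_eq, gH, this]
    convert (jJ (_ + 3)).zero_mem using 1
    linear_combination dD * eE 1 * S3_two
  · have : (2:ℕ) ≤ m := by omega
    simp [tG_eq, gH, this, show 2 ≤ 1 + m by omega]
    convert (jJ (_ + 3)).zero_mem using 1
    linear_combination dD * (eE 2 + eE 1 * eE 1) * S3_two
  · have : (2:ℕ) ≤ m := by omega
    simp [tG_eq, gH, hm, show 3 ≤ 1 + m by omega, show 3 ≤ 2 + m by omega]
    convert (jJ (_ + 3)).zero_mem using 1
    linear_combination dD * (eE 3 + eE 2 * eE 1 + eE 1 * (eE 1 * eE 1 + eE 2)) * S3_two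
  · rw [if_neg (by omega), if_neg (by omega), if_neg (by omega)]
    obtain ⟨t0, h0, k0⟩ := dD_tG m d 0 (by omega)
    obtain ⟨t1, h1, k1⟩ := dD_tG m d 1 (by omega)
    obtain ⟨t2, h2, k2⟩ := dD_tG m d 2 (by omega)
    obtain ⟨t3, h3, k3⟩ := dD_tG m d 3 (by omega)
    obtain ⟨r, rfl⟩ := Nat.exists_eq_add_of_le' h
    have hg : gH (r + 4 - 0 + 2) = eE 1 * gH (r + 4 - 1 + 2) + eE 2 * gH (r + 4 - 2 + 2) +
        eE 3 * gH (r + 4 - 3 + 2) := rfl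
    rw [h0, h1, h2, h3, hg]
    have : dD * t0 + eE 1 * (dD * t1) + eE 2 * (dD * t2) + eE 3 * (dD * t3) ∈ jJ (m + 3) :=
      add_mem (add_mem (add_mem k0 (Ideal.mul_mem_left _ _ k1)) (Ideal.mul_mem_left _ _ k2))
        (Ideal.mul_mem_left _ _ k3)
    convert this using 1
    linear_combination dD * (eE 1 * gH (r + 4 - 1 + 2) + eE 2 * gH (r + 4 - 2 + 2) +
        eE 3 * gH (r + 4 - 3 + 2)) * S3_two

lemma dD_psi_ideal (k m : ℕ) (hk : 3 ≤ k) (hm : 3 ≤ m)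
    (p : MvPolynomial (Fin k ⊕ Fin m) (ZMod 2)) (hp : p ∈ grassIdeal k m) :
    dD * psi k m p ∈ jJ (m + 3) := by
  refine Submodule.span_induction (p := fun p _ => dD * psi k m p ∈ jJ (m + 3))
    ?_ ?_ ?_ ?_ hp
  · rintro _ ⟨d, hd, rfl⟩
    exact dD_psi_comp k m d hk hm hd
  · simp
  · intro a b _ _ ha hb
    rw [map_add, mul_add]; exact add_mem ha hb
  · intro a b _ hb
    rw [smul_eq_mul, map_mul, mul_left_comm]
    exact Ideal.mul_mem_left _ _ hb

lemma coeff_jJ (N : ℕ) (a : Fin 3 →₀ ℕ) (ha : ∀ i, a i < N) (p : S3) (hp : p ∈ jJ N) :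
    coeff a p = 0 := by
  rw [jJ, Ideal.mem_span_insert] at hp
  obtain ⟨u, w, hw, rfl⟩ := hp
  rw [Ideal.mem_span_insert] at hw
  obtain ⟨v, w', hw', rfl⟩ := hw
  obtain ⟨t, rfl⟩ := Ideal.mem_span_singleton'.1 hw'
  have key : ∀ (i : Fin 3) (q : S3), coeff a (q * X i ^ N) = 0 := by
    intro i q
    rw [X_pow_eq_monomial, coeff_mul_monomial', if_neg]
    intro h
    have := h i
    simp at this
    exact absurd (ha i) (by omega)
  simp only [coeff_add, xx, yy, zz, key, add_zero]

lemma final_not_mem (m : ℕ) : (xx * yy * zz) ^ m * dD ∉ jJ (m + 3) := by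
  intro h
  set a : Fin 3 →₀ ℕ := Finsupp.single 0 m + Finsupp.single 1 m + Finsupp.single 2 m with ha
  set b : Fin 3 →₀ ℕ := Finsupp.single 0 2 + Finsupp.single 1 1 with hb
  have h1 := coeff_jJ (m + 3) (a + b) (by
    intro i
    fin_cases i <;> simp [ha, hb]) _ h
  have h2 : (xx * yy * zz) ^ m = monomial a (1 : ZMod 2) := by
    simp only [mul_pow, xx, yy, zz, X_pow_eq_monomial, monomial_mul, mul_one, ha]
  rw [h2, coeff_monomial_mul, one_mul] at h1
  have h3 : dD = monomial b 1 + (xx ^ 2 * zz + yy ^ 2 * xx + yy ^ 2 * zz + zz ^ 2 * xx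
      + zz ^ 2 * yy) := by
    have : monomial b (1 : ZMod 2) = xx ^ 2 * yy := by
      have : yy = X (1 : Fin 3) ^ 1 := by rw [pow_one, yy]
      rw [this]
      simp only [xx, X_pow_eq_monomial, monomial_mul, mul_one, hb]
    rw [this, dD]
    linear_combination (xx * yy * zz) * S3_two
  have key : ∀ i j : Fin 3, i ≠ 0 ∨ j ≠ 1 → i ≠ j → coeff b (X i ^ 2 * X j : S3) = 0 := by
    intro i j hij hne
    have : (X j : S3) = X j ^ 1 := by rw [pow_one]
    rw [this]
    simp only [X_pow_eq_monomial, monomial_mul, mul_one, coeff_monomial]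
    rw [if_neg]
    intro hh
    have e0 := DFunLike.congr_fun hh 0
    have e1 := DFunLike.congr_fun hh 1
    have e2 := DFunLike.congr_fun hh 2
    revert e0 e1 e2 hij hne
    simp only [hb]
    fin_cases i <;> fin_cases j <;> simp [Finsupp.single_apply]
  rw [h3] at h1
  simp only [coeff_add, coeff_monomial, if_true, xx, yy, zz] at h1
  rw [key 0 2 (by decide) (by decide), key 1 0 (by decide) (by decide),
    key 1 2 (by decide) (by decide), key 2 0 (by decide) (by decide),
    key 2 1 (by decide) (by decide)] at h1
  simp at h1

lemma frob3 (a b c : S3) (t : ℕ) : (a + b + c) ^ (2 ^ t) = a ^ (2 ^ t) + b ^ (2 ^ t) + c ^ (2 ^ t) := by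
  rw [add_pow_char_pow, add_pow_char_pow]

lemma prod_not_mem (t : ℕ) (ht : 2 ≤ t) :
    dD * (eE 1 ^ (2 ^ (t + 1)) * eE 2 ^ (2 ^ (t + 1)) * eE 3 ^ (2 ^ t)) ∉ jJ (3 * 2 ^ t + 3) := by
  intro h
  apply final_not_mem (3 * 2 ^ t)
  simp only [eE] at h
  rw [frob3, frob3, pow_succ] at h
  have hq : 4 ≤ 2 ^ t := by
    calc 4 = 2 ^ 2 := rfl
      _ ≤ 2 ^ t := Nat.pow_le_pow_right (by norm_num) ht
  generalize 2 ^ t = q at *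
  have hx : xx ^ (5 * q) ∈ jJ (3 * q + 3) := jJ_x (by omega)
  have hy : yy ^ (5 * q) ∈ jJ (3 * q + 3) := jJ_y (by omega)
  have hz : zz ^ (5 * q) ∈ jJ (3 * q + 3) := jJ_z (by omega)
  have h2 := sub_mem h (add_mem (add_mem
    (Ideal.mul_mem_left _ (dD * (yy ^ (3 * q) * zz ^ q + yy ^ q * zz ^ (3 * q))) hx)
    (Ideal.mul_mem_left _ (dD * (xx ^ (3 * q) * zz ^ q + xx ^ q * zz ^ (3 * q))) hy))
    (Ideal.mul_mem_left _ (dD * (xx ^ (3 * q) * yy ^ q + xx ^ q * yy ^ (3 * q))) hz))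
  convert h2 using 1
  simp only [mul_pow, pow_mul', pow_mul]
  linear_combination (-(dD * (xx ^ q) ^ 3 * (yy ^ q) ^ 3 * (zz ^ q) ^ 3)) * S3_two

/-- For `s ≥ 3` and `3 ≤ k ≤ 2^{s-1}`, `n = 2^s + 2^{s-1} + k`: in `A(k,n)` the product
`w_1^{2^s} · w_2^{2^s} · w_3^{2^{s-1}}` is nonzero. -/
theorem gkn_nonzero (s k n : ℕ) (hs : 3 ≤ s) (hk3 : 3 ≤ k) (hk : k ≤ 2 ^ (s - 1))
    (hn : n = 2 ^ s + 2 ^ (s - 1) + k) :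
    sw k (n - k) ⟨0, by omega⟩ ^ (2 ^ s) * sw k (n - k) ⟨1, by omega⟩ ^ (2 ^ s) *
      sw k (n - k) ⟨2, by omega⟩ ^ (2 ^ (s - 1)) ≠ 0 := by
  intro h
  have hm : n - k = 3 * 2 ^ (s - 1) := by
    have : 2 ^ s = 2 * 2 ^ (s - 1) := by rw [← pow_succ']; congr 1; omega
    omega
  generalize n - k = m at *
  subst hm
  simp only [sw] at h
  rw [← map_pow, ← map_pow, ← map_pow, ← map_mul, ← map_mul, Ideal.Quotient.eq_zero_iff_mem] at h
  have hpos : 1 ≤ 2 ^ (s - 1) := Nat.one_le_two_pow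
  have h2 := dD_psi_ideal k _ hk3 (by omega) _ h
  apply prod_not_mem (s - 1) (by omega)
  simp only [map_mul, map_pow, psi, aeval_X, Sum.elim_inl] at h2
  rwa [show s - 1 + 1 = s by omega]
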